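/- Let (X, υ) be a compact metric measure space such that υ is atomless. Then h(X) = inf { ∫_X Lip f dυ : f Lipschitz on X with c_1(f) = 1 and ∫_X |f| dυ = 1 }, where both infima are taken in (0, ∞] and equal ∞ when the corresponding set of competitors is empty. -/

import Mathlib

open MeasureTheory Metric Filter Set
open scoped Topology NNReal ENNReal
open Classical

variable {X : Type*} [MetricSpace X]

/-- A real-valued function is Lipschitz (with some constant). -/
def IsLipFun (f : X → ℝ) : Prop := ∃ K : ℝ≥0, LipschitzWith K f

/-- The pointwise Lipschitz constant `Lip f (x)`:
`0` if `x` is isolated, and otherwise the limit (= infimum, by monotonicity)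
as `r → 0` of `sup_{y ∈ B_r(x), y ≠ x} |f x - f y| / dist x y`. -/
noncomputable def pLip (f : X → ℝ) (x : X) : ℝ :=
  if 𝓝[≠] x = ⊥ then 0
  else ⨅ r : Ioi (0:ℝ), sSup ((fun y => |f x - f y| / dist x y) '' (ball x r.1 \ {x}))

/-- `γ` is a (unit-speed) minimal geodesic from `x` to `y`. -/
def IsMinGeodesic (γ : ℝ → X) (x y : X) : Prop :=
  γ 0 = x ∧ γ (dist x y) = y ∧
    ∀ s ∈ Icc (0:ℝ) (dist x y), ∀ t ∈ Icc (0:ℝ) (dist x y), dist (γ s) (γ t) = |s - t|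

/-- A metric space is geodesic if any two points are joined by a minimal geodesic. -/
def IsGeodesicSpace (Y : Type*) [MetricSpace Y] : Prop :=
  ∀ x y : Y, ∃ γ : ℝ → Y, IsMinGeodesic γ x y

section MeasureDefs
variable [MeasurableSpace X] (υ : Measure X)

/-- The doubling condition for `κ`. -/
def DoublingFor (κ : ℝ) : Prop :=
  ∀ x : X, ∀ r : ℝ, 0 < r → υ (ball x (2*r)) ≤ (2:ℝ≥0∞) ^ κ * υ (ball x r)

/-- The `(q,p)`-Poincaré inequality for `τ` (for Lipschitz functions). -/
def PoincareFor (q p τ : ℝ) : Prop :=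
  ∀ x : X, ∀ r : ℝ, 0 < r → ∀ f : X → ℝ, IsLipFun f →
    (⨍ y in ball x r, |f y - ⨍ z in ball x r, f z ∂υ| ^ q ∂υ) ^ (1/q) ≤
      τ * r * ((⨍ y in ball x r, (pLip f y) ^ p ∂υ) ^ (1/p))

/-- `F_g(x,y)`: the infimum over minimal geodesics `γ` from `x` to `y` of
`∫_0^{d(x,y)} g(γ(s)) ds`. -/
noncomputable def segF (g : X → ℝ≥0∞) (x y : X) : ℝ≥0∞ :=
  ⨅ γ ∈ {γ : ℝ → X | IsMinGeodesic γ x y}, ∫⁻ s in Icc (0:ℝ) (dist x y), g (γ s)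

/-- The segment inequality for `lam`. -/
def SegmentIneqFor (lam : ℝ) : Prop :=
  ∀ x : X, ∀ r : ℝ, 0 < r → ∀ g : X → ℝ≥0∞, Measurable g →
    (∫⁻ pr in (ball x r) ×ˢ (ball x r), segF g pr.1 pr.2 ∂(υ.prod υ)) ≤
      ENNReal.ofReal (lam * r) * υ (ball x r) * ∫⁻ z in ball x (3*r), g z ∂υ

/-- The first eigenvalue of the `p`-Laplacian (`∞` if there is no competitor). -/
noncomputable def lambda1 (p : ℝ) : ℝ≥0∞ :=
  ⨅ f ∈ {f : X → ℝ | IsLipFun f ∧ (∫ x, |f x| ^ p ∂υ) = 1 ∧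
      (∫ x, |f x| ^ (p-2) * f x ∂υ) = 0},
    ENNReal.ofReal (∫ x, (pLip f x) ^ p ∂υ)

/-- Minkowski's exterior boundary measure
`υ⁺(A) = liminf_{r → 0+} (υ(B_r(A)) - υ(A))/r`. -/
noncomputable def minkBoundary (A : Set X) : ℝ≥0∞ :=
  Filter.liminf (fun r : ℝ => (υ (thickening r A) - υ A) / ENNReal.ofReal r) (𝓝[>] (0:ℝ))

/-- The Cheeger constant (`∞` if there is no competitor). -/
noncomputable def cheeger : ℝ≥0∞ :=
  ⨅ A ∈ {A : Set X | MeasurableSet A ∧ 0 < υ A ∧ υ A ≤ 1/2}, minkBoundary υ A / υ A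

/-- `λ_{1,p}` for `p ∈ [1, ∞)`, with `λ_{1,1} := h(X)` the Cheeger constant. -/
noncomputable def lam1 (p : ℝ) : ℝ≥0∞ := if p = 1 then cheeger υ else lambda1 υ p

/-- `c_p(f) = inf_{c ∈ ℝ} (∫ |f - c|^p dυ)^{1/p}`. -/
noncomputable def cP (p : ℝ) (f : X → ℝ) : ℝ :=
  ⨅ c : ℝ, (∫ x, |f x - c| ^ p ∂υ) ^ (1/p)

/-- `M` is a median of `f`. -/
def IsMedian (f : X → ℝ) (M : ℝ) : Prop :=
  (1/2 : ℝ≥0∞) ≤ υ {x | M ≤ f x} ∧ (1/2 : ℝ≥0∞) ≤ υ {x | f x ≤ M}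

end MeasureDefs

/-- The global Lipschitz constant `sup_{a ≠ b} |f a - f b| / dist a b`. -/
noncomputable def globalLip (f : X → ℝ) : ℝ :=
  sSup {L : ℝ | ∃ a b : X, a ≠ b ∧ L = |f a - f b| / dist a b}

/-- The supremum of the difference quotients of `f` at `x` over the punctured ball of radius `r`. -/
noncomputable def slopeSup (f : X → ℝ) (r : ℝ) (x : X) : ℝ :=
  sSup ((fun y => |f x - f y| / dist x y) '' (ball x r \ {x}))

lemma slopeSup_nonneg (f : X → ℝ) (r : ℝ) (x : X) : 0 ≤ slopeSup f r x := by
  refine Real.sSup_nonneg ?_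
  rintro _ ⟨y, _, rfl⟩
  positivity

lemma slopeSup_le {f : X → ℝ} {r C : ℝ} {x : X} (hC : 0 ≤ C)
    (h : ∀ y ∈ ball x r, |f x - f y| ≤ C * dist x y) : slopeSup f r x ≤ C := by
  refine Real.sSup_le ?_ hC
  rintro _ ⟨y, ⟨hy, hne⟩, rfl⟩
  have hd : 0 < dist x y := dist_pos.2 (Ne.symm hne)
  exact (div_le_iff₀ hd).2 (h y hy)

lemma LipschitzWith.abs_sub_le {K : ℝ≥0} {f : X → ℝ} (hf : LipschitzWith K f) (x y : X) :
    |f x - f y| ≤ K * dist x y := by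
  simpa [Real.dist_eq] using hf.dist_le_mul x y

lemma LipschitzWith.slopeSup_le {K : ℝ≥0} {f : X → ℝ} (hf : LipschitzWith K f) (r : ℝ) (x : X) :
    slopeSup f r x ≤ K :=
  _root_.slopeSup_le K.2 fun y _ => hf.abs_sub_le x y

lemma LipschitzWith.bddAbove_slopes {K : ℝ≥0} {f : X → ℝ} (hf : LipschitzWith K f) (r : ℝ)
    (x : X) : BddAbove ((fun y => |f x - f y| / dist x y) '' (ball x r \ {x})) := by
  refine ⟨K, ?_⟩
  rintro _ ⟨y, ⟨-, hne⟩, rfl⟩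
  have hd : 0 < dist x y := dist_pos.2 (Ne.symm hne)
  exact (div_le_iff₀ hd).2 (hf.abs_sub_le x y)

lemma LipschitzWith.abs_sub_le_slopeSup {K : ℝ≥0} {f : X → ℝ} (hf : LipschitzWith K f) {r : ℝ}
    {x y : X} (hy : y ∈ ball x r) : |f x - f y| ≤ slopeSup f r x * dist x y := by
  rcases eq_or_ne y x with rfl | hne
  · simp
  · have hd : 0 < dist x y := dist_pos.2 (Ne.symm hne)
    exact (div_le_iff₀ hd).1 (le_csSup (hf.bddAbove_slopes r x) ⟨y, ⟨hy, hne⟩, rfl⟩)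

lemma LipschitzWith.slopeSup_mono {K : ℝ≥0} {f : X → ℝ} (hf : LipschitzWith K f) {r s : ℝ}
    (hrs : r ≤ s) (x : X) : slopeSup f r x ≤ slopeSup f s x :=
  _root_.slopeSup_le (slopeSup_nonneg f s x) fun _ hy =>
    hf.abs_sub_le_slopeSup (ball_subset_ball hrs hy)

lemma bddBelow_range_slopeSup (f : X → ℝ) (x : X) :
    BddBelow (range fun r : Ioi (0 : ℝ) => slopeSup f r x) :=
  ⟨0, by rintro _ ⟨r, rfl⟩; exact slopeSup_nonneg f r x⟩

lemma pLip_eq_iInf (f : X → ℝ) (x : X) : pLip f x = ⨅ r : Ioi (0 : ℝ), slopeSup f r x := by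
  unfold pLip
  split_ifs with h
  · refine le_antisymm (Real.iInf_nonneg fun r => slopeSup_nonneg f r x) ?_
    have hx : ({x} : Set X) ∈ 𝓝 x := by
      have : (∅ : Set X) ∈ 𝓝[≠] x := by rw [h]; trivial
      rw [mem_nhdsWithin_iff_exists_mem_nhds_inter] at this
      obtain ⟨u, hu, hsub⟩ := this
      refine mem_of_superset hu fun y hy => ?_
      by_contra hne
      exact hsub ⟨hy, hne⟩
    obtain ⟨r, hr, hball⟩ := Metric.mem_nhds_iff.1 hx
    refine (ciInf_le (bddBelow_range_slopeSup f x) ⟨r, hr⟩).trans ?_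
    refine slopeSup_le le_rfl fun y hy => ?_
    rw [mem_singleton_iff.1 (hball hy)]
    simp
  · rfl

lemma pLip_nonneg (f : X → ℝ) (x : X) : 0 ≤ pLip f x := by
  rw [pLip_eq_iInf]
  exact Real.iInf_nonneg fun r => slopeSup_nonneg f r x

lemma pLip_le_slopeSup (f : X → ℝ) (x : X) {r : ℝ} (hr : 0 < r) : pLip f x ≤ slopeSup f r x := by
  rw [pLip_eq_iInf]
  exact ciInf_le (bddBelow_range_slopeSup f x) ⟨r, hr⟩

lemma pLip_le_of_forall {f : X → ℝ} {C : ℝ} {x : X} (hC : 0 ≤ C)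
    (h : ∀ y, |f x - f y| ≤ C * dist x y) : pLip f x ≤ C :=
  (pLip_le_slopeSup f x one_pos).trans (slopeSup_le hC fun y _ => h y)

lemma LipschitzWith.pLip_le {K : ℝ≥0} {f : X → ℝ} (hf : LipschitzWith K f) (x : X) :
    pLip f x ≤ K :=
  pLip_le_of_forall K.2 fun y => hf.abs_sub_le x y

lemma pLip_eq_zero_of_eventuallyEq {f : X → ℝ} {x : X} (h : ∀ᶠ y in 𝓝 x, f y = f x) :
    pLip f x = 0 := by
  obtain ⟨r, hr, hball⟩ := Metric.eventually_nhds_iff_ball.1 h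
  refine le_antisymm ((pLip_le_slopeSup f x hr).trans (slopeSup_le le_rfl fun y hy => ?_))
    (pLip_nonneg f x)
  simp [hball y hy]

lemma LipschitzWith.pLip_le_mul {K : ℝ≥0} {f g : X → ℝ} (hf : LipschitzWith K f) {C : ℝ}
    (hC : 0 ≤ C) {x : X} (h : ∀ y, |g x - g y| ≤ C * |f x - f y|) : pLip g x ≤ C * pLip f x := by
  rw [pLip_eq_iInf f, Real.mul_iInf_of_nonneg hC]
  refine le_ciInf fun r => (pLip_le_slopeSup g x r.2).trans ?_
  refine _root_.slopeSup_le (mul_nonneg hC (slopeSup_nonneg f r x)) fun y hy => (h y).trans ?_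
  rw [mul_assoc]
  exact mul_le_mul_of_nonneg_left (hf.abs_sub_le_slopeSup hy) hC

lemma LipschitzWith.isOpen_lt_slopeSup {K : ℝ≥0} {f : X → ℝ} (hf : LipschitzWith K f) (r t : ℝ) :
    IsOpen {x | t < slopeSup f r x} := by
  rcases lt_or_ge t 0 with ht | ht
  · rw [eq_univ_of_forall (s := {x | t < slopeSup f r x})
      fun x => ht.trans_le (slopeSup_nonneg f r x)]
    exact isOpen_univ
  · have hset : {x | t < slopeSup f r x} =
        ⋃ y, {x | dist y x < r ∧ t * dist x y < |f x - f y|} := by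
      ext x
      simp only [mem_ofPred_eq, mem_iUnion]
      constructor
      · intro hx
        have hne : ((fun y => |f x - f y| / dist x y) '' (ball x r \ {x})).Nonempty := by
          by_contra hemp
          rw [slopeSup, not_nonempty_iff_eq_empty.1 hemp, Real.sSup_empty] at hx
          linarith
        obtain ⟨_, ⟨y, ⟨hy, hyx⟩, rfl⟩, hlt⟩ := exists_lt_of_lt_csSup hne hx
        exact ⟨y, hy, (lt_div_iff₀ (dist_pos.2 (Ne.symm hyx))).1 hlt⟩
      · rintro ⟨y, hy, hlt⟩
        have hd : 0 < dist x y := by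
          refine dist_pos.2 fun hxy => ?_
          simp [hxy] at hlt
        exact lt_of_mul_lt_mul_right (hlt.trans_le (hf.abs_sub_le_slopeSup (mem_ball.2 hy))) hd.le
    rw [hset]
    have hc := hf.continuous
    refine isOpen_iUnion fun y => IsOpen.and ?_ ?_
    · exact isOpen_lt (by fun_prop) (by fun_prop)
    · exact isOpen_lt (by fun_prop) (by fun_prop)

lemma LipschitzWith.measurable_pLip [MeasurableSpace X] [BorelSpace X] {K : ℝ≥0} {f : X → ℝ}
    (hf : LipschitzWith K f) : Measurable (pLip f) := by
  have hseq : pLip f = fun x => ⨅ n : ℕ, slopeSup f (1 / ((n : ℝ) + 1)) x := by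
    ext x
    have hbdd : BddBelow (range fun n : ℕ => slopeSup f (1 / ((n : ℝ) + 1)) x) :=
      ⟨0, by rintro _ ⟨n, rfl⟩; exact slopeSup_nonneg f _ x⟩
    refine le_antisymm (le_ciInf fun n => pLip_le_slopeSup f x Nat.one_div_pos_of_nat) ?_
    rw [pLip_eq_iInf]
    refine le_ciInf fun r => ?_
    obtain ⟨n, hn⟩ := exists_nat_one_div_lt (mem_Ioi.1 r.2)
    exact (ciInf_le hbdd n).trans (hf.slopeSup_mono hn.le x)
  rw [hseq]
  exact Measurable.iInf fun n => measurable_of_Ioi fun t =>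
    (hf.isOpen_lt_slopeSup _ t).measurableSet

lemma LipschitzWith.ofReal_integral_pLip [MeasurableSpace X] [BorelSpace X] (υ : Measure X)
    [IsFiniteMeasure υ] {K : ℝ≥0} {f : X → ℝ} (hf : LipschitzWith K f) :
    ENNReal.ofReal (∫ x, pLip f x ∂υ) = ∫⁻ x, ENNReal.ofReal (pLip f x) ∂υ := by
  refine ofReal_integral_eq_lintegral_ofReal ?_ (ae_of_all _ (pLip_nonneg f))
  refine Integrable.of_bound hf.measurable_pLip.aestronglyMeasurable K (ae_of_all _ fun x => ?_)
  rw [Real.norm_of_nonneg (pLip_nonneg f x)]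
  exact hf.pLip_le x

/-- The supremum of `g` over the open ball of radius `r`. -/
noncomputable def ballSup (g : X → ℝ) (r : ℝ) (x : X) : ℝ := sSup (g '' ball x r)

lemma LipschitzWith.bddAbove_image_ball {K : ℝ≥0} {g : X → ℝ} (hg : LipschitzWith K g) (r : ℝ)
    (x : X) : BddAbove (g '' ball x r) :=
  (hg.isBounded_image isBounded_ball).bddAbove

lemma LipschitzWith.le_ballSup {K : ℝ≥0} {g : X → ℝ} (hg : LipschitzWith K g) {r : ℝ}
    (hr : 0 < r) (x : X) : g x ≤ ballSup g r x :=
  le_csSup (hg.bddAbove_image_ball r x) ⟨x, mem_ball_self hr, rfl⟩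

lemma LipschitzWith.ballSup_sub_le {K : ℝ≥0} {g : X → ℝ} (hg : LipschitzWith K g) {r s : ℝ}
    (hr : 0 < r) (hrs : r ≤ s) (x : X) : ballSup g r x - g x ≤ slopeSup g s x * r := by
  rw [sub_le_iff_le_add]
  refine csSup_le ⟨_, x, mem_ball_self hr, rfl⟩ ?_
  rintro _ ⟨y, hy, rfl⟩
  have h1 := hg.abs_sub_le_slopeSup (ball_subset_ball hrs hy)
  have h2 : slopeSup g s x * dist x y ≤ slopeSup g s x * r :=
    mul_le_mul_of_nonneg_left (mem_ball'.1 hy).le (slopeSup_nonneg g s x)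
  linarith [neg_abs_le (g x - g y)]

lemma LipschitzWith.setOf_lt_ballSup {K : ℝ≥0} {g : X → ℝ} (hg : LipschitzWith K g) {r : ℝ}
    (hr : 0 < r) (t : ℝ) : {x | t < ballSup g r x} = thickening r {x | t < g x} := by
  ext x
  rw [mem_thickening_iff]
  constructor
  · intro hx
    obtain ⟨_, ⟨y, hy, rfl⟩, hlt⟩ := exists_lt_of_lt_csSup ((nonempty_ball.2 hr).image g) hx
    exact ⟨y, hlt, mem_ball'.1 hy⟩
  · rintro ⟨y, hlt, hy⟩
    exact lt_of_lt_of_le hlt (le_csSup (hg.bddAbove_image_ball r x) ⟨y, mem_ball'.2 hy, rfl⟩)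

lemma LipschitzWith.pLip_posPart_add_le {K : ℝ≥0} {f : X → ℝ} (hf : LipschitzWith K f) {ε : ℝ}
    (hε : 0 < ε) (x : X) :
    pLip (fun y => max (f y - ε) 0) x + pLip (fun y => max (-f y - ε) 0) x ≤ pLip f x := by
  rcases lt_or_ge (f x) ε with hx | hx
  · rw [pLip_eq_zero_of_eventuallyEq (f := fun y => max (f y - ε) 0), zero_add,
      ← one_mul (pLip f x)]
    · refine hf.pLip_le_mul zero_le_one fun y => ?_
      refine (abs_max_sub_max_le_abs _ _ _).trans_eq ?_
      rw [one_mul, ← abs_neg]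
      congr 1
      ring
    · filter_upwards [hf.continuous.continuousAt.eventually (gt_mem_nhds hx)] with y hy
      rw [max_eq_right (by linarith), max_eq_right (by linarith)]
  · rw [pLip_eq_zero_of_eventuallyEq (f := fun y => max (-f y - ε) 0), add_zero,
      ← one_mul (pLip f x)]
    · refine hf.pLip_le_mul zero_le_one fun y => ?_
      refine (abs_max_sub_max_le_abs _ _ _).trans_eq ?_
      rw [one_mul]
      congr 1
      ring
    · have hx' : -ε < f x := by linarith
      filter_upwards [hf.continuous.continuousAt.eventually (lt_mem_nhds hx')] with y hy
      rw [max_eq_right (by linarith), max_eq_right (by linarith)]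

lemma LipschitzWith.posPart_sub_const {K : ℝ≥0} {f : X → ℝ} (hf : LipschitzWith K f) (ε : ℝ) :
    LipschitzWith K fun y => max (f y - ε) 0 :=
  (LipschitzWith.of_dist_le_mul fun x y => by
    simpa [Real.dist_eq] using hf.abs_sub_le x y : LipschitzWith K fun y => f y - ε).max_const 0

lemma cP_one_eq_iInf {Y : Type*} [MeasurableSpace Y] (υ : Measure Y) (f : Y → ℝ) :
    cP υ 1 f = ⨅ c : ℝ, ∫ x, |f x - c| ∂υ := by
  simp [cP]

lemma cP_one_le {Y : Type*} [MeasurableSpace Y] (υ : Measure Y) (f : Y → ℝ) (c : ℝ) :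
    cP υ 1 f ≤ ∫ x, |f x - c| ∂υ := by
  rw [cP_one_eq_iInf]
  exact ciInf_le ⟨0, by rintro _ ⟨c, rfl⟩; exact integral_nonneg fun x => abs_nonneg _⟩ c

lemma measure_lt_le_half_of_forall_integral_le {Y : Type*} [MeasurableSpace Y]
    (υ : Measure Y) [IsProbabilityMeasure υ] {f : Y → ℝ}
    (hf : Measurable f) (hint : Integrable f υ)
    (hmin : ∀ c : ℝ, ∫ x, |f x| ∂υ ≤ ∫ x, |f x - c| ∂υ) {t : ℝ} (ht : 0 < t) :
    υ {x | t < f x} ≤ 1 / 2 := by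
  set S := {x | t < f x}
  have hSm : MeasurableSet S := measurableSet_lt measurable_const hf
  have hle : ∫ x, |f x - t| ∂υ ≤ ∫ x, (|f x| + t - S.indicator (fun _ => 2 * t) x) ∂υ := by
    refine integral_mono (hint.sub (integrable_const t)).abs
      ((hint.abs.add (integrable_const t)).sub ((integrable_const _).indicator hSm)) fun x => ?_
    by_cases hx : x ∈ S
    · have hx' : t < f x := hx
      simp only [indicator_of_mem hx]
      rw [abs_of_pos (sub_pos.2 hx'), abs_of_pos (ht.trans hx')]
      linarith
    · simp only [indicator_of_notMem hx, sub_zero]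
      exact (abs_sub _ _).trans_eq (by rw [abs_of_pos ht])
  have hcalc : ∫ x, (|f x| + t - S.indicator (fun _ => 2 * t) x) ∂υ =
      ∫ x, |f x| ∂υ + t - υ.real S * (2 * t) := by
    have hadd : Integrable (fun x => |f x| + t) υ := hint.abs.add (integrable_const t)
    rw [integral_sub hadd ((integrable_const _).indicator hSm),
      integral_add hint.abs (integrable_const t), integral_indicator_const _ hSm]
    simp
  have hreal : υ.real S ≤ 1 / 2 := by
    have := (hmin t).trans (hle.trans_eq hcalc)
    nlinarith
  rw [← ENNReal.ofReal_toReal (measure_ne_top υ S), show (1 / 2 : ℝ≥0∞) = ENNReal.ofReal (1 / 2) by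
    rw [ENNReal.ofReal_div_of_pos two_pos]; simp]
  exact ENNReal.ofReal_le_ofReal hreal

lemma exists_integral_abs_sub_eq_cP {Y : Type*} [MeasurableSpace Y] (υ : Measure Y)
    [IsProbabilityMeasure υ] {f : Y → ℝ} (hf : Integrable f υ) :
    ∃ c : ℝ, ∫ x, |f x - c| ∂υ = cP υ 1 f := by
  have hint (c : ℝ) : Integrable (fun x => |f x - c|) υ := (hf.sub (integrable_const c)).abs
  have hcont : Continuous fun c : ℝ => ∫ x, |f x - c| ∂υ := by
    refine (LipschitzWith.of_le_add fun a b => ?_ :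
      LipschitzWith 1 fun c : ℝ => ∫ x, |f x - c| ∂υ).continuous
    calc ∫ x, |f x - a| ∂υ ≤ ∫ x, (|f x - b| + dist a b) ∂υ := by
          refine integral_mono (hint a) ((hint b).add (integrable_const _)) fun x => ?_
          rw [dist_comm, Real.dist_eq]
          exact abs_sub_le _ _ _
      _ = ∫ x, |f x - b| ∂υ + dist a b := by
          rw [integral_add (hint b) (integrable_const _)]
          simp
  have hlow (c : ℝ) : ‖c‖ + -∫ x, |f x| ∂υ ≤ ∫ x, |f x - c| ∂υ := by
    have : ∫ _, |c| ∂υ ≤ ∫ x, (|f x - c| + |f x|) ∂υ := by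
      refine integral_mono (integrable_const _) ((hint c).add hf.abs) fun x => ?_
      have := abs_sub_abs_le_abs_sub c (f x)
      rw [abs_sub_comm] at this
      simp only
      linarith
    rw [integral_add (hint c) hf.abs] at this
    simp only [integral_const, probReal_univ, one_smul] at this
    rw [Real.norm_eq_abs]
    linarith
  obtain ⟨c, hc⟩ := hcont.exists_forall_le
    (tendsto_atTop_mono hlow (tendsto_atTop_add_const_right _ _ tendsto_norm_cocompact_atTop))
  refine ⟨c, le_antisymm ?_ (cP_one_le υ f c)⟩
  rw [cP_one_eq_iInf]
  exact le_ciInf hc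

/-- A function interpolating linearly in the distance to `A` between `1` near `A` and `0` away
from it. -/
noncomputable def ramp (A : Set X) (w s : ℝ) (x : X) : ℝ :=
  max (min (w⁻¹ * (s + w - infDist x A)) 1) 0

lemma lipschitzWith_ramp (A : Set X) {w : ℝ} (hw : 0 < w) (s : ℝ) :
    LipschitzWith (w⁻¹).toNNReal (ramp A w s) := by
  refine LipschitzWith.max_const (LipschitzWith.min_const
    (LipschitzWith.of_dist_le_mul fun x y => ?_) 1) 0
  have h := (lipschitz_infDist_pt A).abs_sub_le x y
  rw [Real.dist_eq, Real.coe_toNNReal _ (inv_pos.2 hw).le, ← mul_sub, abs_mul,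
    abs_of_pos (inv_pos.2 hw), sub_sub_sub_cancel_left, abs_sub_comm]
  refine mul_le_mul_of_nonneg_left ?_ (inv_pos.2 hw).le
  simpa using h

lemma ramp_eq_one {A : Set X} {w s : ℝ} (hw : 0 < w) {x : X} (hx : infDist x A ≤ s) :
    ramp A w s x = 1 := by
  have h : 1 ≤ w⁻¹ * (s + w - infDist x A) := by
    rw [inv_mul_eq_div, le_div_iff₀ hw]
    linarith
  rw [ramp, min_eq_right h, max_eq_left zero_le_one]

lemma ramp_eq_zero {A : Set X} {w s : ℝ} (hw : 0 < w) {x : X} (hx : s + w ≤ infDist x A) :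
    ramp A w s x = 0 := by
  refine max_eq_right ((min_le_left _ _).trans ?_)
  exact mul_nonpos_of_nonneg_of_nonpos (inv_pos.2 hw).le (by linarith)

lemma pLip_ramp_le {A : Set X} (hA : A.Nonempty) {w s r : ℝ} (hw : 0 < w) (hs : 0 < s)
    (hr : s + w < r) (x : X) :
    pLip (ramp A w s) x ≤ (thickening r A \ A).indicator (fun _ => w⁻¹) x := by
  by_cases hx : x ∈ thickening r A \ A
  · rw [indicator_of_mem hx]
    simpa [hw.le] using (lipschitzWith_ramp A hw s).pLip_le x
  · rw [indicator_of_notMem hx]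
    refine (pLip_eq_zero_of_eventuallyEq ?_).le
    have hcont : ContinuousAt (fun y => infDist y A) x := (continuous_infDist_pt A).continuousAt
    by_cases hxA : x ∈ A
    · have h0 : infDist x A < s := by rwa [infDist_zero_of_mem hxA]
      filter_upwards [hcont.eventually (gt_mem_nhds h0)] with y hy
      rw [ramp_eq_one hw hy.le, ramp_eq_one hw h0.le]
    · have h0 : s + w < infDist x A := by
        refine hr.trans_le (not_lt.1 fun hlt => hx ⟨?_, hxA⟩)
        exact (mem_thickening_iff_infDist_lt hA).2 hlt
      filter_upwards [hcont.eventually (lt_mem_nhds h0)] with y hy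
      rw [ramp_eq_zero hw hy.le, ramp_eq_zero hw h0.le]

lemma measureReal_sub_le_cP {Y : Type*} [MeasurableSpace Y] (υ : Measure Y)
    [IsProbabilityMeasure υ] {f : Y → ℝ} (hf : Integrable f υ) {A U : Set Y}
    (hA : MeasurableSet A) (hU : MeasurableSet U) (hAU : A ⊆ U) (hone : ∀ x ∈ A, f x = 1)
    (hzero : ∀ x ∉ U, f x = 0) (hhalf : υ.real A ≤ 1 / 2) :
    υ.real A - υ.real (U \ A) ≤ cP υ 1 f := by
  rw [cP_one_eq_iInf]
  refine le_ciInf fun c => ?_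
  have hle : ∫ x, (A.indicator (fun _ => |1 - c|) x + Uᶜ.indicator (fun _ => |c|) x) ∂υ ≤
      ∫ x, |f x - c| ∂υ := by
    refine integral_mono (((integrable_const _).indicator hA).add
      ((integrable_const _).indicator hU.compl)) (hf.sub (integrable_const c)).abs fun x => ?_
    by_cases hxA : x ∈ A
    · simp [hxA, hAU hxA, hone x hxA]
    · by_cases hxU : x ∈ U
      · simp [hxA, hxU]
      · simp [hxA, hxU, hzero x hxU]
  rw [integral_add ((integrable_const _).indicator hA) ((integrable_const _).indicator hU.compl),
    integral_indicator_const _ hA, integral_indicator_const _ hU.compl,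
    probReal_compl_eq_one_sub hU, smul_eq_mul, smul_eq_mul] at hle
  have hUA : υ.real (U \ A) = υ.real U - υ.real A := measureReal_sdiff hAU hA
  have htri : 1 ≤ |1 - c| + |c| := by
    have := abs_add_le (1 - c) c
    simpa using this
  have hm : 0 ≤ υ.real (U \ A) := measureReal_nonneg
  rcases le_or_gt (υ.real A - υ.real (U \ A)) 0 with hneg | hpos
  · exact hneg.trans (integral_nonneg fun x => abs_nonneg _)
  · nlinarith [abs_nonneg c, abs_nonneg (1 - c)]

section Measure

variable [MeasurableSpace X] [BorelSpace X] (υ : Measure X)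

lemma LipschitzWith.measurable_ballSup {K : ℝ≥0} {g : X → ℝ} (hg : LipschitzWith K g) {r : ℝ}
    (hr : 0 < r) : Measurable (ballSup g r) :=
  measurable_of_Ioi fun t => by
    change MeasurableSet {x | t < ballSup g r x}
    rw [hg.setOf_lt_ballSup hr]
    exact isOpen_thickening.measurableSet

lemma LipschitzWith.lintegral_thickening_sub {K : ℝ≥0} {g : X → ℝ} (hg : LipschitzWith K g)
    (hg0 : ∀ x, 0 ≤ g x) (hfin : ∫⁻ x, ENNReal.ofReal (g x) ∂υ ≠ ∞) {r : ℝ} (hr : 0 < r) :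
    ∫⁻ t in Ioi (0 : ℝ), (υ (thickening r {x | t < g x}) - υ {x | t < g x}) =
      ∫⁻ x, ENNReal.ofReal (ballSup g r x - g x) ∂υ := by
  have hlevel := lintegral_eq_lintegral_meas_lt υ (ae_of_all _ hg0)
    hg.continuous.measurable.aemeasurable
  have hsup := lintegral_eq_lintegral_meas_lt υ
    (ae_of_all _ fun x => (hg0 x).trans (hg.le_ballSup hr x))
    (hg.measurable_ballSup hr).aemeasurable
  simp_rw [hg.setOf_lt_ballSup hr] at hsup
  have hmeas : Measurable fun t : ℝ => υ {x | t < g x} :=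
    Antitone.measurable fun s t hst => measure_mono fun x hx => lt_of_le_of_lt hst hx
  rw [lintegral_sub hmeas (hlevel ▸ hfin)
    (ae_of_all _ fun t => measure_mono (self_subset_thickening hr _)), ← hsup, ← hlevel,
    ← lintegral_sub hg.continuous.measurable.ennreal_ofReal hfin
      (ae_of_all _ fun x => ENNReal.ofReal_le_ofReal (hg.le_ballSup hr x))]
  exact lintegral_congr fun x => (ENNReal.ofReal_sub _ (hg0 x)).symm

/-- The coarea inequality for the Minkowski exterior boundary measure. -/
lemma LipschitzWith.lintegral_minkBoundary_le [IsFiniteMeasure υ] {K : ℝ≥0} {g : X → ℝ}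
    (hg : LipschitzWith K g) (hg0 : ∀ x, 0 ≤ g x) (hfin : ∫⁻ x, ENNReal.ofReal (g x) ∂υ ≠ ∞) :
    ∫⁻ t in Ioi (0 : ℝ), minkBoundary υ {x | t < g x} ≤ ∫⁻ x, ENNReal.ofReal (pLip g x) ∂υ := by
  set ρ : ℕ → ℝ := fun n => 1 / ((n : ℝ) + 1)
  have hρ0 : ∀ n, 0 < ρ n := fun n => Nat.one_div_pos_of_nat
  have hρlim : Tendsto ρ atTop (𝓝 0) := tendsto_one_div_add_atTop_nhds_zero_nat
  have hρlim' : Tendsto ρ atTop (𝓝[>] 0) :=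
    tendsto_nhdsWithin_iff.2 ⟨hρlim, Eventually.of_forall hρ0⟩
  have hmeas (n : ℕ) : Measurable fun t : ℝ =>
      (υ (thickening (ρ n) {x | t < g x}) - υ {x | t < g x}) / ENNReal.ofReal (ρ n) := by
    refine Measurable.div_const (Measurable.sub ?_ ?_) _
    · exact Antitone.measurable fun s t hst => measure_mono
        (thickening_subset_of_subset _ fun x hx => lt_of_le_of_lt hst hx)
    · exact Antitone.measurable fun s t hst => measure_mono fun x hx => lt_of_le_of_lt hst hx
  have hint (n : ℕ) : ∫⁻ t in Ioi (0 : ℝ),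
      (υ (thickening (ρ n) {x | t < g x}) - υ {x | t < g x}) / ENNReal.ofReal (ρ n) =
        ∫⁻ x, ENNReal.ofReal ((ballSup g (ρ n) x - g x) / ρ n) ∂υ := by
    simp_rw [ENNReal.ofReal_div_of_pos (hρ0 n), div_eq_mul_inv]
    have hinv : (ENNReal.ofReal (ρ n))⁻¹ ≠ ∞ := by simp [hρ0 n]
    rw [lintegral_mul_const' _ _ hinv, lintegral_mul_const' _ _ hinv,
      hg.lintegral_thickening_sub υ hg0 hfin (hρ0 n)]
  calc ∫⁻ t in Ioi (0 : ℝ), minkBoundary υ {x | t < g x}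
      ≤ ∫⁻ t in Ioi (0 : ℝ), liminf (fun n : ℕ =>
          (υ (thickening (ρ n) {x | t < g x}) - υ {x | t < g x}) / ENNReal.ofReal (ρ n)) atTop :=
        lintegral_mono fun t => by
          refine (liminf_le_liminf_of_le hρlim').trans_eq ?_
          rw [← liminf_comp]
          rfl
    _ ≤ liminf (fun n : ℕ => ∫⁻ t in Ioi (0 : ℝ),
          (υ (thickening (ρ n) {x | t < g x}) - υ {x | t < g x}) / ENNReal.ofReal (ρ n)) atTop :=
        lintegral_liminf_le hmeas
    _ = liminf (fun n : ℕ => ∫⁻ x, ENNReal.ofReal ((ballSup g (ρ n) x - g x) / ρ n) ∂υ) atTop := by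
        simp_rw [hint]
    _ ≤ limsup (fun n : ℕ => ∫⁻ x, ENNReal.ofReal ((ballSup g (ρ n) x - g x) / ρ n) ∂υ) atTop :=
        liminf_le_limsup
    _ ≤ ∫⁻ x, limsup (fun n : ℕ => ENNReal.ofReal ((ballSup g (ρ n) x - g x) / ρ n)) atTop ∂υ := by
        refine limsup_lintegral_le (fun _ => (K : ℝ≥0∞)) (fun n => ?_)
          (fun n => ae_of_all _ fun x => ?_) ?_
        · exact (((hg.measurable_ballSup (hρ0 n)).sub hg.continuous.measurable).div_const
            _).ennreal_ofReal
        · rw [← ENNReal.ofReal_coe_nnreal]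
          refine ENNReal.ofReal_le_ofReal ((div_le_iff₀ (hρ0 n)).2 ?_)
          exact (hg.ballSup_sub_le (hρ0 n) le_rfl x).trans
            (mul_le_mul_of_nonneg_right (hg.slopeSup_le _ x) (hρ0 n).le)
        · rw [lintegral_const]
          exact ENNReal.mul_ne_top ENNReal.coe_ne_top (measure_ne_top _ _)
    _ ≤ ∫⁻ x, ENNReal.ofReal (pLip g x) ∂υ := by
        refine lintegral_mono fun x => ENNReal.le_of_forall_pos_le_add fun ε hε _ => ?_
        have hlt : (⨅ r : Ioi (0 : ℝ), slopeSup g r x) < pLip g x + ε := by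
          rw [← pLip_eq_iInf]
          exact lt_add_of_pos_right _ hε
        obtain ⟨s, hs⟩ := exists_lt_of_ciInf_lt hlt
        have hev : ∀ᶠ n in atTop, ρ n < s := hρlim.eventually (gt_mem_nhds s.2)
        refine limsup_le_of_le (h := hev.mono fun n hn => ?_)
        rw [← ENNReal.ofReal_coe_nnreal, ← ENNReal.ofReal_add (pLip_nonneg g x) ε.coe_nonneg]
        refine ENNReal.ofReal_le_ofReal ((div_le_iff₀ (hρ0 n)).2 ?_)
        exact (hg.ballSup_sub_le (hρ0 n) hn.le x).trans
          (mul_le_mul_of_nonneg_right hs.le (hρ0 n).le)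

lemma LipschitzWith.cheeger_mul_lintegral_le [IsFiniteMeasure υ] {K : ℝ≥0} {g : X → ℝ}
    (hg : LipschitzWith K g) (hg0 : ∀ x, 0 ≤ g x) (hfin : ∫⁻ x, ENNReal.ofReal (g x) ∂υ ≠ ∞)
    (hhalf : ∀ t > 0, υ {x | t < g x} ≤ 1 / 2) :
    cheeger υ * ∫⁻ x, ENNReal.ofReal (g x) ∂υ ≤ ∫⁻ x, ENNReal.ofReal (pLip g x) ∂υ := by
  refine le_trans ?_ (hg.lintegral_minkBoundary_le υ hg0 hfin)
  have hmeas : Measurable fun t : ℝ => υ {x | t < g x} :=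
    Antitone.measurable fun s t hst => measure_mono fun x hx => lt_of_le_of_lt hst hx
  rw [lintegral_eq_lintegral_meas_lt υ (ae_of_all _ hg0) hg.continuous.measurable.aemeasurable,
    ← lintegral_const_mul _ hmeas]
  refine setLIntegral_mono' measurableSet_Ioi fun t ht => ?_
  rcases eq_or_ne (υ {x | t < g x}) 0 with h0 | h0
  · simp [h0]
  · rw [← ENNReal.le_div_iff_mul_le (Or.inl h0) (Or.inl (measure_ne_top _ _))]
    exact iInf₂_le _ ⟨(isOpen_lt continuous_const hg.continuous).measurableSet,
      pos_iff_ne_zero.2 h0, hhalf t ht⟩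

lemma LipschitzWith.integrable [CompactSpace X] [IsFiniteMeasure υ] {K : ℝ≥0} {f : X → ℝ}
    (hf : LipschitzWith K f) : Integrable f υ :=
  hf.continuous.integrable_of_hasCompactSupport (HasCompactSupport.of_compactSpace f)

lemma LipschitzWith.cheeger_le [CompactSpace X] [IsProbabilityMeasure υ] {K : ℝ≥0} {f : X → ℝ}
    (hf : LipschitzWith K f) (hmin : ∀ c : ℝ, ∫ x, |f x| ∂υ ≤ ∫ x, |f x - c| ∂υ)
    (hone : ∫ x, |f x| ∂υ = 1) : cheeger υ ≤ ENNReal.ofReal (∫ x, pLip f x ∂υ) := by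
  have hmin' : ∀ c : ℝ, ∫ x, |-f x| ∂υ ≤ ∫ x, |-f x - c| ∂υ := fun c => by
    simp_rw [abs_neg]
    refine (hmin (-c)).trans_eq (integral_congr_ae (ae_of_all _ fun x => ?_))
    simp only
    rw [← abs_neg]
    congr 1
    ring
  have hint := hf.integrable υ
  have key : ∀ ε : ℝ, 0 < ε →
      cheeger υ * ENNReal.ofReal (1 - ε) ≤ ENNReal.ofReal (∫ x, pLip f x ∂υ) := by
    intro ε hε
    have hp := hf.posPart_sub_const ε
    have hn := hf.neg.posPart_sub_const ε
    simp only [Pi.neg_apply] at hn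
    set p := fun y => max (f y - ε) 0
    set n := fun y => max (-f y - ε) 0
    have hhp := hp.cheeger_mul_lintegral_le υ (fun x => le_max_right _ _)
      (hp.integrable υ).lintegral_lt_top.ne fun t ht => by
        refine (measure_mono fun x hx => ?_).trans
          (measure_lt_le_half_of_forall_integral_le υ hf.continuous.measurable hint hmin ht)
        have := (lt_max_iff.1 (show t < max (f x - ε) 0 from hx)).resolve_right ht.not_gt
        exact show t < f x by linarith
    have hhn := hn.cheeger_mul_lintegral_le υ (fun x => le_max_right _ _)
      (hn.integrable υ).lintegral_lt_top.ne fun t ht => by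
        refine (measure_mono fun x hx => ?_).trans
          (measure_lt_le_half_of_forall_integral_le υ hf.continuous.measurable.neg hint.neg hmin' ht)
        have := (lt_max_iff.1 (show t < max (-f x - ε) 0 from hx)).resolve_right ht.not_gt
        exact show t < -f x by linarith
    have hmass : ENNReal.ofReal (1 - ε) ≤
        ∫⁻ x, ENNReal.ofReal (p x) ∂υ + ∫⁻ x, ENNReal.ofReal (n x) ∂υ := by
      have hsum : Integrable (fun x => p x + n x) υ := (hp.integrable υ).add (hn.integrable υ)
      have hle : 1 - ε ≤ ∫ x, (p x + n x) ∂υ := by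
        calc 1 - ε = ∫ x, (|f x| - ε) ∂υ := by
              rw [integral_sub hint.abs (integrable_const ε), hone]
              simp
          _ ≤ ∫ x, (p x + n x) ∂υ := by
              refine integral_mono (hint.abs.sub (integrable_const ε)) hsum fun x => ?_
              have h1 : f x - ε ≤ p x := le_max_left _ _
              have h2 : 0 ≤ p x := le_max_right _ _
              have h3 : -f x - ε ≤ n x := le_max_left _ _
              have h4 : 0 ≤ n x := le_max_right _ _
              rcases abs_cases (f x) with ⟨h, -⟩ | ⟨h, -⟩ <;> simp only [h] <;> linarith
      refine (ENNReal.ofReal_le_ofReal hle).trans_eq ?_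
      rw [ofReal_integral_eq_lintegral_ofReal hsum
          (ae_of_all _ fun x => add_nonneg (le_max_right _ _) (le_max_right _ _)),
        ← lintegral_add_left hp.continuous.measurable.ennreal_ofReal]
      exact lintegral_congr fun x => ENNReal.ofReal_add (le_max_right _ _) (le_max_right _ _)
    calc cheeger υ * ENNReal.ofReal (1 - ε)
        ≤ cheeger υ * (∫⁻ x, ENNReal.ofReal (p x) ∂υ + ∫⁻ x, ENNReal.ofReal (n x) ∂υ) :=
          mul_le_mul_right hmass _
      _ ≤ ∫⁻ x, ENNReal.ofReal (pLip p x) ∂υ + ∫⁻ x, ENNReal.ofReal (pLip n x) ∂υ := by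
          rw [mul_add]
          exact add_le_add hhp hhn
      _ = ∫⁻ x, ENNReal.ofReal (pLip p x + pLip n x) ∂υ := by
          rw [← lintegral_add_left hp.measurable_pLip.ennreal_ofReal]
          exact lintegral_congr fun x =>
            (ENNReal.ofReal_add (pLip_nonneg _ _) (pLip_nonneg _ _)).symm
      _ ≤ ∫⁻ x, ENNReal.ofReal (pLip f x) ∂υ :=
          lintegral_mono fun x => ENNReal.ofReal_le_ofReal (hf.pLip_posPart_add_le hε x)
      _ = ENNReal.ofReal (∫ x, pLip f x ∂υ) := (hf.ofReal_integral_pLip υ).symm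
  have hlim : Tendsto (fun ε : ℝ => cheeger υ * ENNReal.ofReal (1 - ε)) (𝓝[>] 0)
      (𝓝 (cheeger υ * ENNReal.ofReal (1 - 0))) := by
    refine ENNReal.Tendsto.const_mul ?_ (Or.inl (by simp))
    have hc : Continuous fun ε : ℝ => ENNReal.ofReal (1 - ε) :=
      ENNReal.continuous_ofReal.comp (by fun_prop)
    exact (hc.tendsto 0).mono_left nhdsWithin_le_nhds
  have := le_of_tendsto hlim (eventually_nhdsWithin_of_forall fun ε hε => key ε hε)
  simpa using this

/-- The infimum of the total pointwise Lipschitz constant over normalised Lipschitz functions. -/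
noncomputable def lipInf : ℝ≥0∞ :=
  ⨅ f ∈ {f : X → ℝ | IsLipFun f ∧ cP υ 1 f = 1 ∧ (∫ x, |f x| ∂υ) = 1},
    ENNReal.ofReal (∫ x, pLip f x ∂υ)

lemma LipschitzWith.lipInf_mul_cP_le [CompactSpace X] [IsProbabilityMeasure υ] {K : ℝ≥0}
    {f : X → ℝ} (hf : LipschitzWith K f) :
    lipInf υ * ENNReal.ofReal (cP υ 1 f) ≤ ENNReal.ofReal (∫ x, pLip f x ∂υ) := by
  rcases le_or_gt (cP υ 1 f) 0 with hm | hm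
  · simp [ENNReal.ofReal_of_nonpos hm]
  obtain ⟨c, hc⟩ := exists_integral_abs_sub_eq_cP υ (hf.integrable υ)
  set m := cP υ 1 f
  set g : X → ℝ := fun x => m⁻¹ * (f x - c) with hg
  have hgsub (x y : X) : |g x - g y| = m⁻¹ * |f x - f y| := by
    conv_rhs => rw [← abs_of_pos (inv_pos.2 hm), ← abs_mul]
    congr 1
    simp only [hg]
    ring
  have hglip : LipschitzWith (m⁻¹.toNNReal * K) g := LipschitzWith.of_dist_le_mul fun x y => by
    rw [Real.dist_eq, hgsub, NNReal.coe_mul, Real.coe_toNNReal _ (inv_pos.2 hm).le, mul_assoc]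
    exact mul_le_mul_of_nonneg_left (hf.abs_sub_le x y) (inv_pos.2 hm).le
  have hshift (c' : ℝ) : ∫ x, |g x - c'| ∂υ = m⁻¹ * ∫ x, |f x - (c + m * c')| ∂υ := by
    rw [← integral_const_mul]
    refine integral_congr_ae (ae_of_all _ fun x => ?_)
    simp only [hg]
    conv_rhs => rw [← abs_of_pos (inv_pos.2 hm), ← abs_mul]
    congr 1
    field_simp
    ring
  have hgone : ∫ x, |g x| ∂υ = 1 := by
    have := hshift 0
    simp only [sub_zero, mul_zero, add_zero, hc] at this
    rw [this, inv_mul_cancel₀ hm.ne']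
  have hgcP : cP υ 1 g = 1 := by
    refine le_antisymm ?_ ?_
    · simpa [hgone] using cP_one_le υ g 0
    · rw [cP_one_eq_iInf]
      refine le_ciInf fun c' => ?_
      rw [hshift, ← inv_mul_cancel₀ hm.ne']
      exact mul_le_mul_of_nonneg_left (cP_one_le υ f _) (inv_pos.2 hm).le
  have hint : Integrable (pLip f) υ :=
    Integrable.of_bound hf.measurable_pLip.aestronglyMeasurable K (ae_of_all _ fun x => by
      rw [Real.norm_of_nonneg (pLip_nonneg f x)]
      exact hf.pLip_le x)
  have hle : lipInf υ ≤ ENNReal.ofReal (m⁻¹ * ∫ x, pLip f x ∂υ) := by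
    refine (iInf₂_le g ⟨⟨_, hglip⟩, hgcP, hgone⟩).trans (ENNReal.ofReal_le_ofReal ?_)
    rw [← integral_const_mul]
    exact integral_mono_of_nonneg (ae_of_all _ (pLip_nonneg g)) (hint.const_mul _)
      (ae_of_all _ fun x => hf.pLip_le_mul (inv_pos.2 hm).le fun y => (hgsub x y).le)
  calc lipInf υ * ENNReal.ofReal m
      ≤ ENNReal.ofReal (m⁻¹ * ∫ x, pLip f x ∂υ) * ENNReal.ofReal m := mul_le_mul_left hle _
    _ = ENNReal.ofReal (∫ x, pLip f x ∂υ) := by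
        rw [← ENNReal.ofReal_mul (mul_nonneg (inv_pos.2 hm).le (integral_nonneg (pLip_nonneg f)))]
        congr 1
        field_simp

lemma lipInf_mul_sub_le [CompactSpace X] [IsProbabilityMeasure υ] {A : Set X}
    (hA : MeasurableSet A) (hne : A.Nonempty) (hhalf : υ A ≤ 1 / 2) {r : ℝ} (hr : 0 < r) :
    lipInf υ * (υ A - υ (thickening r A \ A)) ≤ υ (thickening r A \ A) / ENNReal.ofReal r := by
  have hhalf' : υ.real A ≤ 1 / 2 := by
    simpa [measureReal_def] using ENNReal.toReal_mono (by simp) hhalf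
  have hD : MeasurableSet (thickening r A \ A) := isOpen_thickening.measurableSet.diff hA
  have key : ∀ w ∈ Ioo 0 r, lipInf υ * (υ A - υ (thickening r A \ A)) ≤
      ENNReal.ofReal w⁻¹ * υ (thickening r A \ A) := by
    rintro w ⟨hw, hwr⟩
    obtain ⟨s, hs, hsr⟩ : ∃ s, 0 < s ∧ s + w < r := ⟨(r - w) / 2, by linarith, by linarith⟩
    have hf := lipschitzWith_ramp A hw s
    calc lipInf υ * (υ A - υ (thickening r A \ A))
        = lipInf υ * ENNReal.ofReal (υ.real A - υ.real (thickening r A \ A)) := by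
          rw [ENNReal.ofReal_sub _ measureReal_nonneg, ofReal_measureReal, ofReal_measureReal]
      _ ≤ lipInf υ * ENNReal.ofReal (cP υ 1 (ramp A w s)) := by
          refine mul_le_mul_right (ENNReal.ofReal_le_ofReal ?_) _
          refine measureReal_sub_le_cP υ (hf.integrable υ) hA isOpen_thickening.measurableSet
            (self_subset_thickening hr A) (fun x hx => ramp_eq_one hw ?_)
            (fun x hx => ramp_eq_zero hw ?_) hhalf'
          · rw [infDist_zero_of_mem hx]
            exact hs.le
          · exact hsr.le.trans (not_lt.1 fun h => hx ((mem_thickening_iff_infDist_lt hne).2 h))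
      _ ≤ ENNReal.ofReal (∫ x, pLip (ramp A w s) x ∂υ) := hf.lipInf_mul_cP_le υ
      _ = ∫⁻ x, ENNReal.ofReal (pLip (ramp A w s) x) ∂υ := hf.ofReal_integral_pLip υ
      _ ≤ ∫⁻ x, (thickening r A \ A).indicator (fun _ => ENNReal.ofReal w⁻¹) x ∂υ := by
          refine lintegral_mono fun x => ?_
          refine (ENNReal.ofReal_le_ofReal (pLip_ramp_le hne hw hs hsr x)).trans_eq ?_
          by_cases hx : x ∈ thickening r A \ A <;> simp only [hx, indicator_of_mem,
            indicator_of_notMem, not_false_eq_true, ENNReal.ofReal_zero]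
      _ = ENNReal.ofReal w⁻¹ * υ (thickening r A \ A) := lintegral_indicator_const hD _
  have hlim : Tendsto (fun w : ℝ => ENNReal.ofReal w⁻¹ * υ (thickening r A \ A)) (𝓝[<] r)
      (𝓝 (ENNReal.ofReal r⁻¹ * υ (thickening r A \ A))) := by
    refine ENNReal.Tendsto.mul_const ?_ (Or.inr (measure_ne_top _ _))
    exact ENNReal.tendsto_ofReal ((tendsto_inv₀ hr.ne').mono_left nhdsWithin_le_nhds)
  have hle := ge_of_tendsto hlim (mem_of_superset (Ioo_mem_nhdsLT hr) key)
  rwa [ENNReal.ofReal_inv_of_pos hr, mul_comm _ (υ _), ← div_eq_mul_inv] at hle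

lemma lipInf_mul_le_minkBoundary [CompactSpace X] [IsProbabilityMeasure υ] {A : Set X}
    (hA : MeasurableSet A) (h0 : 0 < υ A) (hhalf : υ A ≤ 1 / 2) :
    lipInf υ * υ A ≤ minkBoundary υ A := by
  refine le_of_forall_gt fun L hL => ?_
  obtain ⟨M, hM, hML⟩ := exists_between hL
  refine lt_of_le_of_lt ?_ hML
  have hMtop : M ≠ ∞ := ne_top_of_lt hML
  have hfreq := frequently_lt_of_liminf_lt (by isBoundedDefault) hM
  have key : ∀ η : ℝ, 0 < η → lipInf υ * (υ A - ENNReal.ofReal η * M) ≤ M := by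
    intro η hη
    obtain ⟨r, hlt, hr, hrη⟩ := (hfreq.and_eventually (Ioo_mem_nhdsGT hη)).exists
    rw [← measure_sdiff (self_subset_thickening hr A) hA.nullMeasurableSet (measure_ne_top _ _)]
      at hlt
    refine le_trans ?_ ((lipInf_mul_sub_le υ hA (nonempty_of_measure_ne_zero h0.ne') hhalf
      hr).trans hlt.le)
    refine mul_le_mul_right (tsub_le_tsub_left ?_ _) _
    have hr' : ENNReal.ofReal r ≠ 0 := by simpa using hr
    have := (ENNReal.div_le_iff_le_mul (Or.inl hr') (Or.inl ENNReal.ofReal_ne_top)).1 hlt.le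
    rw [mul_comm] at this
    exact this.trans (mul_le_mul_left (ENNReal.ofReal_le_ofReal hrη.le) _)
  have hlim : Tendsto (fun η : ℝ => lipInf υ * (υ A - ENNReal.ofReal η * M)) (𝓝[>] 0)
      (𝓝 (lipInf υ * (υ A - ENNReal.ofReal 0 * M))) := by
    refine ENNReal.Tendsto.const_mul (ENNReal.Tendsto.sub tendsto_const_nhds
      (ENNReal.Tendsto.mul_const ?_ (Or.inr hMtop)) (Or.inl (measure_ne_top _ _)))
      (Or.inl (by simpa using h0.ne'))
    exact (ENNReal.continuous_ofReal.tendsto 0).mono_left nhdsWithin_le_nhds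
  simpa using le_of_tendsto hlim (eventually_nhdsWithin_of_forall key)

end Measure

/-- variational characterization of the Cheeger constant. -/
theorem stmt3 {X : Type*} [MetricSpace X] [CompactSpace X] [MeasurableSpace X] [BorelSpace X]
    (υ : Measure X) [IsProbabilityMeasure υ]
    (hna : ∀ x : X, υ {x} = 0) :
    cheeger υ =
      ⨅ f ∈ {f : X → ℝ | IsLipFun f ∧ cP υ 1 f = 1 ∧ (∫ x, |f x| ∂υ) = 1},
        ENNReal.ofReal (∫ x, pLip f x ∂υ) := by
  refine le_antisymm (le_iInf₂ fun f hf => ?_) (le_iInf₂ fun A hA => ?_)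
  · obtain ⟨⟨K, hK⟩, hc, hone⟩ := hf
    exact hK.cheeger_le υ (fun c => by rw [hone, ← hc]; exact cP_one_le υ f c) hone
  · obtain ⟨hAm, h0, hhalf⟩ := hA
    rw [ENNReal.le_div_iff_mul_le (Or.inl h0.ne') (Or.inl (measure_ne_top _ _))]
    exact lipInf_mul_le_minkBoundary υ hAm h0 hhalf
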